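/- Let A and B be m×m real matrices that commute (AB = BA), with spectral radius sp(A) < 1, and let k ≥ 0 be an integer. Then ∑_{n≥0} Pₙ(A, kA + B) = (∑_{n≥0} Pₙ(A,B)) · ((I − A)⁻¹)ᵏ, both series being convergent and I − A being invertible. -/

import Mathlib

open Matrix

/-- `Pmat A B n = ∏_{i=1}^{n} (A + (1/i) B)`. -/
noncomputable def Pmat {m : ℕ} (A B : Matrix (Fin m) (Fin m) ℝ) :
    ℕ → Matrix (Fin m) (Fin m) ℝ
  | 0 => 1
  | k + 1 => Pmat A B k * (A + ((k + 1 : ℕ) : ℝ)⁻¹ • B)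

open Filter Topology
open scoped NNReal ENNReal

section Algebra

variable {m : ℕ} {A B : Matrix (Fin m) (Fin m) ℝ}

theorem Pmat_succ (A B : Matrix (Fin m) (Fin m) ℝ) (n : ℕ) :
    Pmat A B (n + 1) = Pmat A B n * (A + ((n + 1 : ℕ) : ℝ)⁻¹ • B) := rfl

theorem Pmat_add_left_mul (hAB : A * B = B * A) (n : ℕ) :
    Pmat A (A + B) n * (A + B) = ((n + 1 : ℕ) : ℝ) • Pmat A B (n + 1) := by
  have key : ∀ c : ℝ, c ≠ 0 → ∀ M N : Matrix (Fin m) (Fin m) ℝ,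
      c • (M * (A + c⁻¹ • N)) = M * (c • A + N) := fun c hc M N => by
    rw [← mul_smul_comm, smul_add, smul_inv_smul₀ hc]
  induction n with
  | zero => simp [Pmat]
  | succ n ih =>
    have hn : ((n + 1 : ℕ) : ℝ) ≠ 0 := by positivity
    have hcomm : Commute (A + ((n + 1 : ℕ) : ℝ)⁻¹ • (A + B)) (A + B) := by
      have h : Commute A (A + B) := (Commute.refl A).add_right hAB
      exact h.add_left ((Commute.refl (A + B)).smul_left _)
    rw [Pmat_succ A (A + B), mul_assoc, hcomm.eq, ← mul_assoc, ih, smul_mul_assoc, key _ hn,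
      Pmat_succ A B (n + 1), key _ (by positivity)]
    congr 1
    push_cast
    module

theorem Pmat_add_left_succ (hAB : A * B = B * A) (n : ℕ) :
    Pmat A (A + B) (n + 1) = Pmat A (A + B) n * A + Pmat A B (n + 1) := by
  rw [Pmat_succ A (A + B), mul_add, mul_smul_comm, Pmat_add_left_mul hAB,
    inv_smul_smul₀ (by positivity)]

theorem tsum_Pmat_add_left_mul (hAB : A * B = B * A)
    (h₁ : Summable (Pmat A (A + B))) (h₂ : Summable (Pmat A B)) :
    (∑' n, Pmat A (A + B) n) * (1 - A) = ∑' n, Pmat A B n := by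
  have h₃ : Summable fun n => Pmat A B (n + 1) := (summable_nat_add_iff 1).2 h₂
  have h := h₁.tsum_eq_zero_add
  simp_rw [Pmat_add_left_succ hAB] at h
  rw [(h₁.mul_right A).tsum_add h₃, h₁.tsum_mul_right] at h
  rw [mul_sub, mul_one, h₂.tsum_eq_zero_add, sub_eq_iff_eq_add]
  refine h.trans ?_
  change 1 + (_ + _) = 1 + _ + _
  abel

end Algebra

section Convergence

open scoped Matrix.Norms.Operator

/-- In a complex Banach algebra, an element of spectral radius less than one has geometrically
decaying powers. -/
theorem exists_norm_pow_le_of_spectralRadius_lt_one {R : Type*} [NormedRing R]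
    [NormedAlgebra ℂ R] [CompleteSpace R] {a : R} (ha : spectralRadius ℂ a < 1) :
    ∃ C r : ℝ, 0 < C ∧ 0 < r ∧ r < 1 ∧ ∀ n : ℕ, ‖a ^ n‖ ≤ C * r ^ n := by
  obtain ⟨r, har, hr1⟩ := ENNReal.lt_iff_exists_nnreal_btwn.1 ha
  have hr0 : 0 < r := ENNReal.coe_pos.1 (bot_le.trans_lt har)
  have hev := eventually_lt_of_limsup_lt
    ((spectrum.limsup_pow_nnnorm_pow_one_div_le_spectralRadius a).trans_lt har)
  have hO : (fun n : ℕ => a ^ n) =O[atTop] fun n : ℕ => (r : ℝ) ^ n := by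
    refine Asymptotics.IsBigO.of_bound 1 ?_
    filter_upwards [hev, eventually_gt_atTop 0] with n hn hn0
    have hn0' : (0 : ℝ) < n := by exact_mod_cast hn0
    have h := ENNReal.rpow_le_rpow hn.le hn0'.le
    rw [← ENNReal.rpow_mul, one_div_mul_cancel hn0'.ne', ENNReal.rpow_one,
      ENNReal.rpow_natCast] at h
    have h' : ‖a ^ n‖₊ ≤ r ^ n := by exact_mod_cast h
    rw [one_mul, Real.norm_of_nonneg (by positivity)]
    exact_mod_cast h'
  obtain ⟨C, hC, h⟩ := Asymptotics.bound_of_isBigO_nat_atTop hO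
  refine ⟨C, r, hC, hr0, by exact_mod_cast hr1, fun n => ?_⟩
  simpa using h (x := n) (by positivity)

theorem Matrix.linfty_opNorm_map_ofReal {m : ℕ} (A : Matrix (Fin m) (Fin m) ℝ) :
    ‖A.map (algebraMap ℝ ℂ)‖ = ‖A‖ := by
  simp [Matrix.linfty_opNorm_def]

variable {m : ℕ} {A : Matrix (Fin m) (Fin m) ℝ}

theorem exists_norm_pow_le_of_spectralRadius_map_lt_one
    (hA : spectralRadius ℂ (A.map (algebraMap ℝ ℂ)) < 1) :
    ∃ C r : ℝ, 0 < C ∧ 0 < r ∧ r < 1 ∧ ∀ n : ℕ, ‖A ^ n‖ ≤ C * r ^ n := by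
  obtain ⟨C, r, hC, hr0, hr1, h⟩ := exists_norm_pow_le_of_spectralRadius_lt_one hA
  refine ⟨C, r, hC, hr0, hr1, fun n => ?_⟩
  rw [← Matrix.linfty_opNorm_map_ofReal, Matrix.map_pow]
  exact h n

theorem isUnit_one_sub_of_spectralRadius_map_lt_one
    (hA : spectralRadius ℂ (A.map (algebraMap ℝ ℂ)) < 1) : IsUnit (1 - A) := by
  obtain ⟨C, r, -, hr0, hr1, h⟩ := exists_norm_pow_le_of_spectralRadius_map_lt_one hA
  have hs : Summable fun n : ℕ => A ^ n :=
    .of_norm_bounded ((summable_geometric_of_lt_one hr0.le hr1).mul_left C) h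
  exact ⟨⟨_, _, hs.one_sub_mul_tsum_pow, hs.tsum_pow_mul_one_sub⟩, rfl⟩

theorem norm_pow_mul_Pmat_le {B : Matrix (Fin m) (Fin m) ℝ} (hAB : A * B = B * A) {C r : ℝ}
    (h : ∀ n : ℕ, ‖A ^ n‖ ≤ C * r ^ n) (n j : ℕ) :
    ‖A ^ j * Pmat A B n‖ ≤
      C * r ^ j * ∏ i ∈ Finset.range n, (r + ((i + 1 : ℕ) : ℝ)⁻¹ * ‖B‖) := by
  have hcomm : ∀ n, Commute A (Pmat A B n) := fun n => by
    induction n with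
    | zero => exact Commute.one_right A
    | succ n ih =>
      exact ih.mul_right ((Commute.refl A).add_right (Commute.smul_right hAB _))
  induction n generalizing j with
  | zero => simpa [Pmat] using h j
  | succ n ih =>
    have hsplit : A ^ j * Pmat A B (n + 1) = A ^ (j + 1) * Pmat A B n +
        ((n + 1 : ℕ) : ℝ)⁻¹ • (A ^ j * Pmat A B n * B) := by
      rw [Pmat_succ, mul_add, mul_add, ← (hcomm n).eq, mul_smul_comm, mul_smul_comm, pow_succ]
      simp only [mul_assoc]
    rw [hsplit, Finset.prod_range_succ]
    have hsmul : ‖((n + 1 : ℕ) : ℝ)⁻¹ • (A ^ j * Pmat A B n * B)‖ ≤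
        ((n + 1 : ℕ) : ℝ)⁻¹ *
          ((C * r ^ j * ∏ i ∈ Finset.range n, (r + ((i + 1 : ℕ) : ℝ)⁻¹ * ‖B‖)) * ‖B‖) := by
      rw [norm_smul, Real.norm_of_nonneg (by positivity)]
      gcongr
      exact (norm_mul_le _ _).trans (by gcongr; exact ih j)
    refine (norm_add_le _ _).trans ((add_le_add (ih (j + 1)) hsmul).trans_eq ?_)
    ring

theorem summable_prod_range_add_inv_mul {r b : ℝ} (hr0 : 0 < r) (hr1 : r < 1) (hb : 0 ≤ b) :
    Summable fun n : ℕ => ∏ i ∈ Finset.range n, (r + ((i + 1 : ℕ) : ℝ)⁻¹ * b) := by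
  have hpos : ∀ n : ℕ, 0 < ∏ i ∈ Finset.range n, (r + ((i + 1 : ℕ) : ℝ)⁻¹ * b) :=
    fun n => Finset.prod_pos fun i _ => by positivity
  refine summable_of_ratio_test_tendsto_lt_one hr1 (.of_forall fun n => (hpos n).ne') ?_
  have hlim : Tendsto (fun n : ℕ => r + ((n + 1 : ℕ) : ℝ)⁻¹ * b) atTop (𝓝 r) := by
    have h := (tendsto_inv_atTop_nhds_zero_nat (𝕜 := ℝ)).comp (tendsto_add_atTop_nat 1)
    simpa using (h.mul_const b).const_add r
  refine hlim.congr fun n => ?_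
  rw [Real.norm_of_nonneg (hpos _).le, Real.norm_of_nonneg (hpos _).le, Finset.prod_range_succ,
    mul_div_cancel_left₀ _ (hpos n).ne']

theorem summable_Pmat {B : Matrix (Fin m) (Fin m) ℝ} (hAB : A * B = B * A)
    (hA : spectralRadius ℂ (A.map (algebraMap ℝ ℂ)) < 1) : Summable (Pmat A B) := by
  obtain ⟨C, r, -, hr0, hr1, h⟩ := exists_norm_pow_le_of_spectralRadius_map_lt_one hA
  refine .of_norm_bounded
    ((summable_prod_range_add_inv_mul hr0 hr1 (norm_nonneg B)).mul_left C) fun n => ?_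
  simpa using norm_pow_mul_Pmat_le hAB h n 0

end Convergence

/-- For commuting `A`, `B` with `sp(A) < 1` and integer `k ≥ 0`:
`P(1; A, kA+B) = P(1;A,B) (I-A)^{-k}`, both series converging and `I - A`
being invertible. -/
theorem tsum_Pmat_shift {m : ℕ} (A B : Matrix (Fin m) (Fin m) ℝ) (k : ℕ)
    (hAB : A * B = B * A)
    (hA : spectralRadius ℂ (A.map (algebraMap ℝ ℂ)) < 1) :
    IsUnit (1 - A) ∧
    Summable (fun n : ℕ => Pmat A ((k : ℝ) • A + B) n) ∧
    Summable (fun n : ℕ => Pmat A B n) ∧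
    ∑' n : ℕ, Pmat A ((k : ℝ) • A + B) n =
      (∑' n : ℕ, Pmat A B n) * ((1 - A)⁻¹) ^ k := by
  have hU := isUnit_one_sub_of_spectralRadius_map_lt_one hA
  have hcomm : ∀ k : ℕ, A * ((k : ℝ) • A + B) = ((k : ℝ) • A + B) * A := fun k =>
    ((Commute.refl A).smul_right (k : ℝ)).add_right hAB
  have hs : ∀ k : ℕ, Summable (Pmat A ((k : ℝ) • A + B)) := fun k => summable_Pmat (hcomm k) hA
  refine ⟨hU, hs k, summable_Pmat hAB hA, ?_⟩
  induction k with
  | zero => simp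
  | succ k ih =>
    have hk : ((k + 1 : ℕ) : ℝ) • A + B = A + ((k : ℝ) • A + B) := by
      push_cast
      module
    have hsk := hs (k + 1)
    rw [hk] at hsk ⊢
    rw [pow_succ, ← mul_assoc, ← ih, ← tsum_Pmat_add_left_mul (hcomm k) hsk (hs k),
      Matrix.mul_nonsing_inv_cancel_right _ _ ((Matrix.isUnit_iff_isUnit_det _).1 hU)]
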